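/- For all integers i, k, n with 2 ≤ i ≤ n and k ≥ i + 1, the ordered configuration space F_k^{i,n} is simply connected. -/

import Mathlib

noncomputable section

open Module Submodule

/-- Topology on the projectivization (quotient topology). -/
instance (K V : Type*) [DivisionRing K] [AddCommGroup V] [Module K V] [TopologicalSpace V] :
    TopologicalSpace (Projectivization K V) :=
  inferInstanceAs (TopologicalSpace (Quotient (projectivizationSetoid K V)))

/-- The complex projective space `ℂP^n`. -/
abbrev CP (n : ℕ) := Projectivization ℂ (Fin (n + 1) → ℂ)

/-- `Fconf k i n` is the ordered configuration space `F_k^{i,n}` of `k` pairwise distinct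
points of `ℂP^n` whose projective span has dimension `i` (i.e. the span of representative
vectors has linear dimension `i + 1`). -/
def Fconf (k i n : ℕ) : Set (Fin k → CP n) :=
  {x | Function.Injective x ∧
    finrank ℂ (span ℂ (Set.range fun j => (x j).rep)) = i + 1}

section Auxiliary

open Set unitInterval Topology

/-- Weak van Kampen theorem. -/
theorem simplyConnectedSpace_of_open_cover {X : Type*} [TopologicalSpace X] (x₀ : X)
    (𝒰 : Set (Set X)) (hopen : ∀ U ∈ 𝒰, IsOpen U) (hcover : ∀ x, ∃ U ∈ 𝒰, x ∈ U)
    (hbase : ∀ U ∈ 𝒰, x₀ ∈ U)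
    (hconn : ∀ U ∈ 𝒰, ∀ V ∈ 𝒰, IsPathConnected (U ∩ V))
    (hnull : ∀ U ∈ 𝒰, ∀ (x y : X) (p q : Path x y), range p ⊆ U → range q ⊆ U →
      p.Homotopic q) : SimplyConnectedSpace X := by
  have hin : ∀ U ∈ 𝒰, ∀ V ∈ 𝒰, ∀ x ∈ U ∩ V, ∃ r : Path x x₀, range r ⊆ U ∩ V := by
    intro U hU V hV x hx
    obtain ⟨r, hr⟩ := (hconn U hU V hV).joinedIn x hx x₀ ⟨hbase U hU, hbase V hV⟩
    exact ⟨r, range_subset_iff.2 hr⟩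
  have hex : ∀ x, ∃ δ : Path x x₀, ∀ V ∈ 𝒰, ∀ p : Path x x₀, range p ⊆ V →
      p.Homotopic δ := by
    intro x
    obtain ⟨U, hU, hxU⟩ := hcover x
    obtain ⟨δ, hδ⟩ := hin U hU U hU x ⟨hxU, hxU⟩
    refine ⟨δ, fun V hV p hp => ?_⟩
    obtain ⟨r, hr⟩ := hin U hU V hV x ⟨hxU, hp ⟨0, p.source⟩⟩
    exact (hnull V hV _ _ p r hp (hr.trans inter_subset_right)).trans
      (hnull U hU _ _ r δ (hr.trans inter_subset_left) (hδ.trans inter_subset_left))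
  choose δ hδ using hex
  have hstep : ∀ V ∈ 𝒰, ∀ (x y : X) (p : Path x y), range p ⊆ V →
      (p.trans (δ y)).Homotopic (δ x) := by
    intro V hV x y p hp
    have hy : y ∈ V := hp ⟨1, p.target⟩
    obtain ⟨r, hr⟩ := hin V hV V hV y ⟨hy, hy⟩
    have hrV := hr.trans inter_subset_left
    refine (Path.Homotopic.hcomp (.refl p) (hδ y V hV r hrV).symm).trans (hδ x V hV _ ?_)
    rw [Path.trans_range]
    exact union_subset hp hrV
  have hall : ∀ (x y : X) (p : Path x y), (p.trans (δ y)).Homotopic (δ x) := by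
    intro x y p
    obtain ⟨t, ht0, htm, ⟨N, hN⟩, ht⟩ :=
      exists_monotone_Icc_subset_open_cover_unitInterval (c := fun U : 𝒰 => p ⁻¹' U.1)
        (fun U => (hopen _ U.2).preimage p.continuous) (fun s _ => by
          obtain ⟨U, hU, hs⟩ := hcover (p s)
          exact mem_iUnion.2 ⟨⟨U, hU⟩, hs⟩)
    have key : ∀ n, ((p.subpath 0 (t n)).trans (δ (p (t n)))).Homotopic (δ (p 0)) := by
      intro n
      induction n with
      | zero =>
        rw [ht0, Path.subpath_self]
        exact ⟨Path.Homotopy.reflTrans _⟩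
      | succ n ih =>
        obtain ⟨⟨U, hU⟩, hsub⟩ := ht n
        have h1 := hstep U hU _ _ (p.subpath (t n) (t (n + 1))) (by
          rw [Path.range_subpath_of_le _ _ _ (htm n.le_succ)]
          exact image_subset_iff.2 hsub)
        have h2 : ((p.subpath 0 (t n)).trans (p.subpath (t n) (t (n + 1)))).Homotopic
            (p.subpath 0 (t (n + 1))) := ⟨Path.Homotopy.subpathTransSubpath _ _ _ _⟩
        refine (Path.Homotopic.hcomp h2.symm (.refl _)).trans ?_
        refine Path.Homotopic.trans ⟨Path.Homotopy.transAssoc _ _ _⟩ ?_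
        exact (Path.Homotopic.hcomp (.refl _) h1).trans ih
    have h := key N
    rw [hN N le_rfl, Path.subpath_zero_one] at h
    obtain ⟨p, rfl, rfl⟩ := p
    exact h
  rw [simply_connected_iff_paths_homotopic']
  refine ⟨⟨⟨x₀⟩, fun x y => ⟨(δ x).trans (δ y).symm⟩⟩, fun {x y} p q => ?_⟩
  have h := (hall x y p).trans (hall x y q).symm
  rw [← Path.Homotopic.Quotient.eq] at h ⊢
  simp only [Path.Homotopic.Quotient.mk_trans] at h
  have h' := congrArg (fun r => r.trans (Path.Homotopic.Quotient.mk (δ y)).symm) h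
  simpa using h'

theorem homotopic_of_factor {X Y : Type*} [TopologicalSpace X] [TopologicalSpace Y]
    [SimplyConnectedSpace Y] {U : Set X} (Φ : Y → X) (hΦ : Continuous Φ) (Ψ : U → Y)
    (hΨ : Continuous Ψ) (hid : ∀ u, Φ (Ψ u) = u) (x y : X) (p q : Path x y)
    (hp : range p ⊆ U) (hq : range q ⊆ U) : p.Homotopic q := by
  have hx : x ∈ U := hp ⟨0, p.source⟩
  have hy : y ∈ U := hp ⟨1, p.target⟩
  let lift (r : Path x y) (hr : range r ⊆ U) : Path (Ψ ⟨x, hx⟩) (Ψ ⟨y, hy⟩) :=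
    { toFun := fun t => Ψ ⟨r t, hr ⟨t, rfl⟩⟩
      continuous_toFun := hΨ.comp (r.continuous.subtype_mk _)
      source' := by simp
      target' := by simp }
  have h := ((SimplyConnectedSpace.paths_homotopic (lift p hp) (lift q hq)).map
    ⟨Φ, hΦ⟩).pathCast (hid ⟨x, hx⟩).symm (hid ⟨y, hy⟩).symm
  convert h using 1
  · ext t; exact (hid ⟨p t, _⟩).symm
  · ext t; exact (hid ⟨q t, _⟩).symm

theorem SimplyConnectedSpace.prod {X Y : Type*} [TopologicalSpace X] [TopologicalSpace Y]
    [SimplyConnectedSpace X] [SimplyConnectedSpace Y] : SimplyConnectedSpace (X × Y) := by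
  rw [simply_connected_iff_paths_homotopic]
  refine ⟨inferInstance, fun x y => ⟨fun p q => ?_⟩⟩
  rw [← Path.Homotopic.prod_projLeft_projRight (a₁ := x.1) (b₁ := x.2) (a₂ := y.1) (b₂ := y.2) p,
    ← Path.Homotopic.prod_projLeft_projRight (a₁ := x.1) (b₁ := x.2) (a₂ := y.1) (b₂ := y.2) q]
  congr 1 <;> exact Subsingleton.elim _ _

section Thin

variable {V : Type*} [NormedAddCommGroup V] [NormedSpace ℝ V]

/-- The join of `Z` with any line has Hausdorff dimension less than that of the ambient space. -/
def IsThin (Z : Set V) : Prop :=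
  ∀ a b : V, dimH {z | ∃ s t : ℝ, ∃ h ∈ Z, z = (1 + s + t) • h - s • a - t • b} <
    Module.finrank ℝ V

theorem IsThin.union {Z₁ Z₂ : Set V} (h₁ : IsThin Z₁) (h₂ : IsThin Z₂) : IsThin (Z₁ ∪ Z₂) := by
  intro a b
  refine lt_of_le_of_lt (dimH_mono
    (t := {z | ∃ s t : ℝ, ∃ h ∈ Z₁, z = (1 + s + t) • h - s • a - t • b} ∪
      {z | ∃ s t : ℝ, ∃ h ∈ Z₂, z = (1 + s + t) • h - s • a - t • b}) ?_) ?_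
  · rintro z ⟨s, t, h, hh | hh, rfl⟩
    exacts [Or.inl ⟨s, t, h, hh, rfl⟩, Or.inr ⟨s, t, h, hh, rfl⟩]
  · rw [dimH_union]
    exact max_lt (h₁ a b) (h₂ a b)

theorem IsThin.iUnion {ι : Type*} [Finite ι] [FiniteDimensional ℝ V] [Nontrivial V] {Z : ι → Set V}
    (h : ∀ i, IsThin (Z i)) : IsThin (⋃ i, Z i) := by
  intro a b
  have hsub : {z | ∃ s t : ℝ, ∃ h ∈ ⋃ i, Z i, z = (1 + s + t) • h - s • a - t • b} ⊆
      ⋃ i, {z | ∃ s t : ℝ, ∃ h ∈ Z i, z = (1 + s + t) • h - s • a - t • b} := by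
    rintro z ⟨s, t, w, hw, rfl⟩
    obtain ⟨i, hi⟩ := mem_iUnion.1 hw
    exact mem_iUnion.2 ⟨i, s, t, w, hi, rfl⟩
  refine lt_of_le_of_lt (dimH_mono hsub) ?_
  rw [dimH_iUnion]
  have hpos : (0 : ENNReal) < (Module.finrank ℝ V : ENNReal) := by
    exact_mod_cast Module.finrank_pos (R := ℝ) (M := V)
  cases isEmpty_or_nonempty ι
  · simpa using hpos
  · obtain ⟨i, hi⟩ := exists_eq_ciSup_of_finite
      (f := fun i => dimH {z | ∃ s t : ℝ, ∃ h ∈ Z i, z = (1 + s + t) • h - s • a - t • b})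
    rw [← hi]
    exact h i a b

theorem IsThin.of_subset_range {P : Type*} [NormedAddCommGroup P] [NormedSpace ℝ P]
    [FiniteDimensional ℝ P] {Z : Set V} (h : P → V) (hh : ContDiff ℝ 1 h) (hZ : Z ⊆ range h)
    (hdim : Module.finrank ℝ P + 3 ≤ Module.finrank ℝ V) : IsThin Z := by
  intro a b
  let g : P × ℝ × ℝ → V := fun u => (1 + u.2.1 + u.2.2) • h u.1 - u.2.1 • a - u.2.2 • b
  have hg : ContDiff ℝ 1 g := by fun_prop
  refine lt_of_le_of_lt (dimH_mono (t := range g) ?_) (lt_of_le_of_lt hg.dimH_range_le ?_)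
  · rintro z ⟨s, t, w, hw, rfl⟩
    obtain ⟨u, rfl⟩ := hZ hw
    exact ⟨(u, s, t), rfl⟩
  · have : Module.finrank ℝ (P × ℝ × ℝ) < Module.finrank ℝ V := by
      simp only [Module.finrank_prod, Module.finrank_self]
      omega
    exact_mod_cast this

theorem IsThin.exists_triangle {ι : Type*} [Finite ι] [FiniteDimensional ℝ V] [Nontrivial V]
    {Z : Set V} (hZ : IsThin Z) (a b : ι → V) (hab : ∀ i, segment ℝ (a i) (b i) ⊆ Zᶜ) :
    ∃ z, ∀ i, ∀ α β γ : ℝ, 0 ≤ α → 0 ≤ β → 0 ≤ γ → α + β + γ = 1 →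
      α • a i + β • b i + γ • z ∉ Z := by
  let bad : ι → Set V := fun i =>
    {z | ∃ s t : ℝ, ∃ h ∈ Z, z = (1 + s + t) • h - s • a i - t • b i}
  have hbad : dimH (⋃ i, bad i) < Module.finrank ℝ V := by
    rw [dimH_iUnion]
    have hpos : (0 : ENNReal) < (Module.finrank ℝ V : ENNReal) := by
      exact_mod_cast Module.finrank_pos (R := ℝ) (M := V)
    cases isEmpty_or_nonempty ι
    · simpa using hpos
    · obtain ⟨i, hi⟩ := exists_eq_ciSup_of_finite (f := fun i => dimH (bad i))
      rw [← hi]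
      exact hZ _ _
  obtain ⟨z, hz⟩ := (dense_compl_of_dimH_lt_finrank hbad).nonempty
  refine ⟨z, fun i α β γ hα hβ hγ hsum hmem => ?_⟩
  rcases eq_or_ne γ 0 with rfl | hγ0
  · exact hab i ⟨α, β, hα, hβ, by linarith, rfl⟩ (by simpa using hmem)
  · refine hz (mem_iUnion.2 ⟨i, α / γ, β / γ, _, hmem, ?_⟩)
    have h1 : 1 + α / γ + β / γ = γ⁻¹ := by field_simp; linarith
    rw [h1, smul_add, smul_add, smul_smul, smul_smul, smul_smul, inv_mul_cancel₀ hγ0, one_smul,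
      div_eq_inv_mul, div_eq_inv_mul]
    abel

theorem IsThin.nonempty_compl [FiniteDimensional ℝ V] [Nontrivial V] {Z : Set V}
    (hZ : IsThin Z) : Zᶜ.Nonempty := by
  refine Set.nonempty_compl.2 fun h => ?_
  have := hZ 0 0
  subst h
  rw [show {z : V | ∃ s t : ℝ, ∃ h ∈ univ, z = (1 + s + t) • h - s • (0 : V) - t • (0 : V)} = univ
    from eq_univ_of_forall fun z => ⟨0, 0, z, trivial, by simp⟩, Real.dimH_univ_eq_finrank] at this
  exact lt_irrefl _ this

theorem isOpen_setOf_segment_subset {O : Set V} (hO : IsOpen O) (p : V) :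
    IsOpen {x | segment ℝ p x ⊆ O} := by
  have h : {x | segment ℝ p x ⊆ O} =
      {x | ∀ t ∈ Icc (0 : ℝ) 1, AffineMap.lineMap p x t ∈ O} := by
    ext x
    rw [mem_ofPred_eq, segment_eq_image_lineMap, image_subset_iff]
    rfl
  rw [h, isOpen_iff_mem_nhds]
  intro x hx
  have hc : Continuous fun q : V × ℝ => (AffineMap.lineMap p q.1 q.2 : V) := by
    simp only [AffineMap.lineMap_apply]
    fun_prop
  have := isCompact_Icc.eventually_forall_of_forall_eventually (x₀ := x)
    (P := fun x t => (AffineMap.lineMap p x t : V) ∈ O) (K := Icc (0 : ℝ) 1)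
    (fun t ht => hc.continuousAt.eventually (hO.mem_nhds (hx t ht)))
  exact this

theorem IsThin.simplyConnectedSpace_compl [FiniteDimensional ℝ V] [Nontrivial V] {Z : Set V}
    (hZ : IsThin Z) (hclosed : IsClosed Z) : SimplyConnectedSpace ↥(Zᶜ) := by
  have hO : IsOpen Zᶜ := hclosed.isOpen_compl
  obtain ⟨b, hb⟩ := hZ.nonempty_compl
  have hself : ∀ x ∈ Zᶜ, segment ℝ x x ⊆ Zᶜ := by simp
  let W : V → Set V := fun p => {x | segment ℝ p x ⊆ Zᶜ}
  have hWZ : ∀ p, W p ⊆ Zᶜ := fun p x hx => hx (right_mem_segment ℝ p x)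
  refine simplyConnectedSpace_of_open_cover (⟨b, hb⟩ : ↥(Zᶜ))
    {U | ∃ p, b ∈ W p ∧ U = Subtype.val ⁻¹' W p} ?_ ?_ ?_ ?_ ?_
  · rintro U ⟨p, -, rfl⟩
    exact (isOpen_setOf_segment_subset hO p).preimage continuous_subtype_val
  · rintro ⟨x, hx⟩
    obtain ⟨p, hp⟩ := hZ.exists_triangle ![x, b] ![x, b] (by
      intro i; fin_cases i
      exacts [hself x hx, hself b hb])
    refine ⟨_, ⟨p, ?_, rfl⟩, ?_⟩
    · rintro _ ⟨γ, α, hγ, hα, h1, rfl⟩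
      have := hp 1 α 0 γ hα le_rfl hγ (by linarith)
      simpa [add_comm] using this
    · rintro _ ⟨γ, α, hγ, hα, h1, rfl⟩
      have := hp 0 α 0 γ hα le_rfl hγ (by linarith)
      simpa [add_comm] using this
  · rintro U ⟨p, hp, rfl⟩
    exact hp
  · rintro _ ⟨p, hp, rfl⟩ _ ⟨q, hq, rfl⟩
    rw [← preimage_inter]
    refine IsPathConnected.preimage_coe ?_ (inter_subset_left.trans (hWZ p))
    refine ⟨b, ⟨hp, hq⟩, fun {x} hx => ?_⟩
    obtain ⟨z, hz⟩ := hZ.exists_triangle ![p, p, q, q] ![x, b, x, b] (by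
      intro i; fin_cases i
      exacts [hx.1, hp, hx.2, hq])
    have tri : ∀ c y : V, (∀ α β γ : ℝ, 0 ≤ α → 0 ≤ β → 0 ≤ γ → α + β + γ = 1 →
        α • c + β • y + γ • z ∉ Z) → segment ℝ y z ⊆ W c := by
      rintro c y h _ ⟨β, γ, hβ, hγ, h1, rfl⟩ _ ⟨α, δ, hα, hδ, h2, rfl⟩
      have := h α (δ * β) (δ * γ) hα (mul_nonneg hδ hβ) (mul_nonneg hδ hγ) (by
        rw [add_assoc, ← mul_add, h1, mul_one, h2])
      rw [smul_add, smul_smul, smul_smul, ← add_assoc]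
      exact this
    have hb' : JoinedIn (W p ∩ W q) b z := JoinedIn.of_segment_subset
      (subset_inter (tri p b (hz 1)) (tri q b (hz 3)))
    have hx' : JoinedIn (W p ∩ W q) x z := JoinedIn.of_segment_subset
      (subset_inter (tri p x (hz 0)) (tri q x (hz 2)))
    exact hb'.trans hx'.symm
  · rintro _ ⟨p, hp, rfl⟩ x y γ₁ γ₂ h₁ h₂
    have hpW : p ∈ W p := by
      simpa [W] using hp (left_mem_segment ℝ p b)
    have hstar : StarConvex ℝ p (W p) := by
      rw [starConvex_iff_segment_subset]
      intro x hx y hy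
      exact ((convex_segment p x).segment_subset (left_mem_segment ℝ p x) hy).trans hx
    have := hstar.contractibleSpace ⟨p, hpW⟩
    exact homotopic_of_factor (Y := W p) (fun w => ⟨w, hWZ p w.2⟩) (by fun_prop)
      (fun u => ⟨u.1.1, u.2⟩) (by fun_prop) (fun u => rfl) x y γ₁ γ₂ h₁ h₂

end Thin

section Lines

variable {W : Type*} [NormedAddCommGroup W] [NormedSpace ℂ W]

/-- A complex line joining two points of `O` leaves `O` in at most countably many points. -/
def LineGeneric (O : Set W) : Prop :=
  ∀ x ∈ O, ∀ y ∈ O, {z : ℂ | AffineMap.lineMap x y z ∉ O}.Countable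

theorem LineGeneric.inter {O₁ O₂ : Set W} (h₁ : LineGeneric O₁) (h₂ : LineGeneric O₂) :
    LineGeneric (O₁ ∩ O₂) := by
  intro x hx y hy
  refine ((h₁ x hx.1 y hy.1).union (h₂ x hx.2 y hy.2)).mono fun z hz => ?_
  by_contra h
  simp only [mem_union, mem_ofPred_eq, not_or, not_not] at h
  exact hz h

theorem LineGeneric.iInter {ι : Type*} [Countable ι] {O : ι → Set W}
    (h : ∀ i, LineGeneric (O i)) : LineGeneric (⋂ i, O i) := by
  intro x hx y hy
  refine (countable_iUnion fun i => h i x (mem_iInter.1 hx i) y (mem_iInter.1 hy i)).mono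
    fun z hz => ?_
  simpa using hz

theorem countable_zeros_of_differentiable {f : ℂ → ℂ} (hf : Differentiable ℂ f) {z₀ : ℂ}
    (h : f z₀ ≠ 0) : {z | f z = 0}.Countable := by
  have hc := (hf.differentiableOn.analyticOnNhd isOpen_univ).preimage_zero_mem_codiscrete h
  have hd := (mem_codiscrete'.1 hc).2
  rw [← preimage_compl, compl_compl] at hd
  exact (HereditarilyLindelofSpace.isLindelof _).countable hd.to_subtype

theorem differentiable_lineMap_apply (x y : W) :
    Differentiable ℂ fun z : ℂ => (AffineMap.lineMap x y z : W) := by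
  simp only [AffineMap.lineMap_apply_module']
  fun_prop

theorem LineGeneric.of_exists_ne_zero {ι : Type*} (φ : ι → W → ℂ)
    (hφ : ∀ i, Differentiable ℂ (φ i)) : LineGeneric {x | ∃ i, φ i x ≠ 0} := by
  rintro x ⟨i, hi⟩ y -
  have hd : Differentiable ℂ fun z : ℂ => φ i (AffineMap.lineMap x y z) := by
    exact (hφ i).comp (differentiable_lineMap_apply x y)
  refine (countable_zeros_of_differentiable hd (z₀ := 0) (by simpa using hi)).mono fun z hz => ?_
  by_contra h
  exact hz ⟨i, h⟩

theorem LineGeneric.of_ne_zero (φ : W → ℂ) (hφ : Differentiable ℂ φ) :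
    LineGeneric {x | φ x ≠ 0} := by
  simpa using LineGeneric.of_exists_ne_zero (fun _ : Unit => φ) fun _ => hφ

theorem LineGeneric.isPathConnected {O : Set W} (h : LineGeneric O) (hne : O.Nonempty) :
    IsPathConnected O := by
  obtain ⟨x, hx⟩ := hne
  refine ⟨x, hx, fun {y} hy => ?_⟩
  have hpc := (h x hx y hy).isPathConnected_compl_of_one_lt_rank (by simp)
  have hj := hpc.joinedIn 0 (by simpa using hx) 1 (by simpa using hy)
  have := hj.map_continuousOn (f := fun z : ℂ => (AffineMap.lineMap x y z : W))
    (differentiable_lineMap_apply x y).continuous.continuousOn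
  simp only [AffineMap.lineMap_apply_zero, AffineMap.lineMap_apply_one] at this
  refine this.mono ?_
  rintro _ ⟨z, hz, rfl⟩
  exact not_not.1 hz

/-- Two nonempty sets defined by the nonvanishing of an entire function meet. -/
theorem exists_ne_zero_and_ne_zero {φ ψ : W → ℂ} (hφ : Differentiable ℂ φ)
    (hψ : Differentiable ℂ ψ) {x y : W} (hx : φ x ≠ 0) (hy : ψ y ≠ 0) :
    ∃ w, φ w ≠ 0 ∧ ψ w ≠ 0 := by
  have hl := differentiable_lineMap_apply x y
  have h₁ := countable_zeros_of_differentiable (hφ.comp hl) (z₀ := 0) (by simpa using hx)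
  have h₂ := countable_zeros_of_differentiable (hψ.comp hl) (z₀ := 1) (by simpa using hy)
  obtain ⟨z, hz⟩ := ((h₁.union h₂).dense_compl ℝ).nonempty
  simp only [mem_compl_iff, mem_union, mem_ofPred_eq, not_or] at hz
  exact ⟨_, hz⟩

theorem Differentiable.matrix_det {m : Type*} [Fintype m] [DecidableEq m]
    {M : W → Matrix m m ℂ} (hM : ∀ a b, Differentiable ℂ fun x => M x a b) :
    Differentiable ℂ fun x => (M x).det := by
  simp only [Matrix.det_apply']
  fun_prop

end Lines

namespace Projectivization

variable {V : Type*} [NormedAddCommGroup V] [NormedSpace ℂ V]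

theorem isOpenQuotientMap_mk' : IsOpenQuotientMap (mk' ℂ : {v : V // v ≠ 0} → _) := by
  refine ⟨Quotient.mk_surjective, continuous_quotient_mk', fun U hU => ?_⟩
  change IsOpen ((mk' ℂ : {v : V // v ≠ 0} → _) ⁻¹' (mk' ℂ '' U))
  have : (mk' ℂ : {v : V // v ≠ 0} → _) ⁻¹' (mk' ℂ '' U) =
      ⋃ c : ℂˣ, (fun v : {v : V // v ≠ 0} =>
        (⟨c • v.1, (smul_ne_zero_iff_ne c).2 v.2⟩ : {v : V // v ≠ 0})) ⁻¹' U := by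
    ext v
    simp only [mem_preimage, mem_image, mem_iUnion, mk'_eq_mk]
    constructor
    · rintro ⟨u, hu, h⟩
      obtain ⟨c, hc⟩ := (mk_eq_mk_iff ℂ _ _ u.2 v.2).1 h
      exact ⟨c, by convert hu⟩
    · rintro ⟨c, hc⟩
      exact ⟨_, hc, (mk_eq_mk_iff ℂ _ _ _ v.2).2 ⟨c, rfl⟩⟩
  rw [this]
  refine isOpen_iUnion fun c => hU.preimage ?_
  exact (continuous_subtype_val.const_smul c).subtype_mk _

theorem continuous_mk {T : Type*} [TopologicalSpace T] {g : T → V} (hg : Continuous g)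
    (h0 : ∀ t, g t ≠ 0) : Continuous fun t => mk ℂ (g t) (h0 t) :=
  isOpenQuotientMap_mk'.continuous.comp (hg.subtype_mk h0)

/-- The representative of a point on which the functional `f` takes the value one. -/
def normalize (f : Dual ℂ V) (x : Projectivization ℂ V) : V := (f x.rep)⁻¹ • x.rep

theorem normalize_mk (f : Dual ℂ V) (v : V) (hv : v ≠ 0) :
    normalize f (mk ℂ v hv) = (f v)⁻¹ • v := by
  obtain ⟨a, ha⟩ := exists_smul_eq_mk_rep ℂ v hv
  rw [normalize, ← ha, Units.smul_def, map_smul, smul_eq_mul, mul_inv, smul_smul, mul_right_comm,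
    inv_mul_cancel₀ a.ne_zero, one_mul]

theorem apply_rep_mk_ne_zero_iff (f : Dual ℂ V) (v : V) (hv : v ≠ 0) :
    f (mk ℂ v hv).rep ≠ 0 ↔ f v ≠ 0 := by
  obtain ⟨a, ha⟩ := exists_smul_eq_mk_rep ℂ v hv
  rw [← ha, Units.smul_def, map_smul, smul_eq_mul, mul_ne_zero_iff]
  simp

theorem apply_normalize (f : Dual ℂ V) {x : Projectivization ℂ V} (h : f x.rep ≠ 0) :
    f (normalize f x) = 1 := by
  simp [normalize, h]

theorem normalize_ne_zero (f : Dual ℂ V) {x : Projectivization ℂ V} (h : f x.rep ≠ 0) :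
    normalize f x ≠ 0 := fun h0 => by simpa [h0] using apply_normalize f h

theorem mk_normalize (f : Dual ℂ V) {x : Projectivization ℂ V} (h : f x.rep ≠ 0) :
    mk ℂ (normalize f x) (normalize_ne_zero f h) = x := by
  conv_rhs => rw [← mk_rep x]
  rw [mk_eq_mk_iff']
  exact ⟨_, rfl⟩

variable [FiniteDimensional ℂ V]

theorem isOpen_setOf_apply_rep_ne_zero (f : Dual ℂ V) :
    IsOpen {x : Projectivization ℂ V | f x.rep ≠ 0} := by
  rw [← isOpenQuotientMap_mk'.isQuotientMap.isOpen_preimage]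
  have : mk' ℂ ⁻¹' {x : Projectivization ℂ V | f x.rep ≠ 0} = {v | f v.1 ≠ 0} := by
    ext v
    exact apply_rep_mk_ne_zero_iff f v.1 v.2
  rw [this]
  have hf : Continuous f := f.continuous_of_finiteDimensional
  exact isOpen_ne_fun (hf.comp continuous_subtype_val) continuous_const

theorem continuousOn_normalize (f : Dual ℂ V) :
    ContinuousOn (normalize f) {x | f x.rep ≠ 0} := by
  rw [isOpenQuotientMap_mk'.isQuotientMap.continuousOn_isOpen_iff
    (isOpen_setOf_apply_rep_ne_zero f)]
  have hf : Continuous f := f.continuous_of_finiteDimensional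
  have : normalize f ∘ mk' ℂ = fun v : {v : V // v ≠ 0} => (f v.1)⁻¹ • v.1 :=
    funext fun v => normalize_mk f v.1 v.2
  rw [this]
  refine ContinuousOn.smul (ContinuousOn.inv₀ ?_ fun v hv => ?_) ?_
  · exact (hf.comp continuous_subtype_val).continuousOn
  · exact (apply_rep_mk_ne_zero_iff f v.1 v.2).1 hv
  · exact continuous_subtype_val.continuousOn

end Projectivization

section IndependentPoints

open Projectivization

variable {E : Type*} [NormedAddCommGroup E] [NormedSpace ℂ E]

/-- The vectors `v j` are linearly independent modulo the subspace `K`. -/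
def IndepMod {m : ℕ} (K : Submodule ℂ E) (v : Fin m → E) : Prop :=
  ∀ c : Fin m → ℂ, ∑ j, c j • v j ∈ K → c = 0

theorem IndepMod.notMem {m : ℕ} {K : Submodule ℂ E} {v : Fin m → E} (h : IndepMod K v)
    (j : Fin m) : v j ∉ K := by
  intro hj
  have := congrFun (h (Pi.single j 1) (by simpa [Pi.single_apply, ite_smul] using hj)) j
  simp at this

theorem IndepMod.ne_zero {m : ℕ} {K : Submodule ℂ E} {v : Fin m → E} (h : IndepMod K v)
    (j : Fin m) : v j ≠ 0 := fun h0 => h.notMem j (h0 ▸ K.zero_mem)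

theorem IndepMod.smul {m : ℕ} {K : Submodule ℂ E} {v : Fin m → E} (h : IndepMod K v)
    (a : Fin m → ℂ) (ha : ∀ j, a j ≠ 0) : IndepMod K fun j => a j • v j := by
  intro c hc
  have := h (fun j => c j * a j) (by simpa only [smul_smul] using hc)
  funext j
  simpa [ha j] using congrFun this j

theorem IndepMod.of_mk_eq {m : ℕ} {K : Submodule ℂ E} {v w : Fin m → E} (hw : ∀ j, w j ≠ 0)
    (h : IndepMod K v) (hvw : ∀ j, mk ℂ (v j) (h.ne_zero j) = mk ℂ (w j) (hw j)) :
    IndepMod K w := by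
  have : ∀ j, ∃ a : ℂˣ, a • v j = w j := fun j =>
    (mk_eq_mk_iff ℂ _ _ (hw j) (h.ne_zero j)).1 (hvw j).symm
  choose a ha using this
  convert h.smul (fun j => (a j : ℂ)) fun j => (a j).ne_zero using 2 with j
  exact (ha j).symm

variable (E) in
/-- Ordered tuples of points of a projective space that are independent modulo `K`. -/
def indepConf (K : Submodule ℂ E) (m : ℕ) : Set (Fin m → Projectivization ℂ E) :=
  {x | IndepMod K fun j => (x j).rep}

theorem mk_mem_indepConf {m : ℕ} {K : Submodule ℂ E} {v : Fin m → E} (h : IndepMod K v) :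
    (fun j => mk ℂ (v j) (h.ne_zero j)) ∈ indepConf E K m :=
  h.of_mk_eq (fun _ => rep_nonzero _) fun _ => (mk_rep _).symm

theorem indepMod_iff_exists_det_ne_zero {m : ℕ} {K : Submodule ℂ E} {v : Fin m → E} :
    IndepMod K v ↔ ∃ q : {q : E →ₗ[ℂ] Fin m → ℂ // K ≤ LinearMap.ker q},
      (Matrix.of fun a b => q.1 (v b) a).det ≠ 0 := by
  constructor
  · intro h
    let f : (Fin m → ℂ) →ₗ[ℂ] E ⧸ K := Fintype.linearCombination ℂ fun j => K.mkQ (v j)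
    have hf : LinearMap.ker f = ⊥ := by
      rw [LinearMap.ker_eq_bot']
      intro c hc
      refine h c ?_
      rw [← Submodule.Quotient.mk_eq_zero, ← Submodule.mkQ_apply]
      simpa [f, Fintype.linearCombination_apply] using hc
    obtain ⟨g, hg⟩ := f.exists_leftInverse_of_injective hf
    refine ⟨⟨g ∘ₗ K.mkQ, fun x hx => by simp [(Submodule.Quotient.mk_eq_zero K).2 hx]⟩, ?_⟩
    have : (Matrix.of fun a b => (g ∘ₗ K.mkQ) (v b) a) = 1 := by
      ext a b
      have := congrFun (LinearMap.congr_fun hg (Pi.single b 1)) a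
      simp only [f, LinearMap.comp_apply, Fintype.linearCombination_apply_single, one_smul,
        LinearMap.id_apply] at this
      rw [Matrix.of_apply, LinearMap.comp_apply, this, Matrix.one_apply, Pi.single_apply]
    rw [this, Matrix.det_one]
    exact one_ne_zero
  · rintro ⟨⟨q, hq⟩, hdet⟩ c hc
    refine Matrix.eq_zero_of_mulVec_eq_zero hdet ?_
    have := hq hc
    rw [LinearMap.mem_ker, map_sum] at this
    funext a
    simpa [Matrix.mulVec, dotProduct, mul_comm] using congrFun this a

theorem IndepMod.cons_transvection {m : ℕ} {K : Submodule ℂ E} {ℓ : Dual ℂ E}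
    (hK : K ≤ LinearMap.ker ℓ) {e u : E} (he : ℓ e = 1) (hu : ℓ u = 0) {w : Fin m → E}
    (h : IndepMod (K ⊔ ℂ ∙ e) w) :
    IndepMod K (Fin.cons (e + u) fun j => w j + ℓ (w j) • u : Fin (m + 1) → E) := by
  intro c hc
  simp only [Fin.sum_univ_succ, Fin.cons_zero, Fin.cons_succ] at hc
  set s : E := c 0 • e + ∑ j : Fin m, c j.succ • w j with hs
  have hsum : c 0 • (e + u) + ∑ j : Fin m, c j.succ • (w j + ℓ (w j) • u) = s + ℓ s • u := by
    have : ℓ s = c 0 + ∑ j : Fin m, c j.succ * ℓ (w j) := by simp [hs, he]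
    rw [this, hs]
    simp only [smul_add, Finset.sum_add_distrib, add_smul, Finset.sum_smul, smul_smul]
    abel
  rw [hsum] at hc
  have hs0 : ℓ s = 0 := by simpa [hu] using hK hc
  rw [hs0, zero_smul, add_zero] at hc
  have hc1 : (fun j : Fin m => c j.succ) = 0 := by
    refine h _ (Submodule.mem_sup.2 ⟨s, hc, -(c 0) • e, ?_, ?_⟩)
    · exact Submodule.mem_span_singleton.2 ⟨_, rfl⟩
    · rw [hs]; simp
  have hc2 : c 0 = 0 := by
    have : ℓ s = c 0 := by
      have h' : ∀ j : Fin m, c j.succ = 0 := congrFun hc1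
      simp [hs, he, h']
    rw [← this, hs0]
  funext j
  refine Fin.cases hc2 (fun j => congrFun hc1 j) j

theorem IndepMod.tail_transvection {m : ℕ} {K : Submodule ℂ E} {ℓ : Dual ℂ E}
    (hK : K ≤ LinearMap.ker ℓ) {e u : E} (he : ℓ e = 1) (hu : ℓ u = 0) {v : Fin (m + 1) → E}
    (h : IndepMod K v) (h0 : v 0 = e + u) :
    IndepMod (K ⊔ ℂ ∙ e) fun j : Fin m => v j.succ - ℓ (v j.succ) • u := by
  intro c hc
  obtain ⟨k, hk, y, hy, hsum⟩ := Submodule.mem_sup.1 hc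
  obtain ⟨a, rfl⟩ := Submodule.mem_span_singleton.1 hy
  have key : ∑ j, (Fin.cons (-a) c : Fin (m + 1) → ℂ) j • v j ∈ K := by
    rw [Fin.sum_univ_succ]
    simp only [Fin.cons_zero, Fin.cons_succ, h0]
    simp only [smul_sub, Finset.sum_sub_distrib, smul_smul, ← Finset.sum_smul] at hsum
    have hℓ := congrArg ℓ hsum
    simp only [map_add, map_smul, map_sub, map_sum, LinearMap.mem_ker.1 (hK hk), he, hu,
      smul_eq_mul, mul_one, mul_zero, sub_zero, zero_add] at hℓ
    rw [← hℓ] at hsum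
    have : -a • (e + u) + ∑ j : Fin m, c j • v j.succ = k := by
      have h2 : k = ∑ x, c x • v x.succ - a • u - a • e := eq_sub_of_add_eq hsum
      rw [h2, smul_add, neg_smul, neg_smul]
      abel
    rwa [this]
  have := h _ key
  funext j
  simpa using congrFun this j.succ

theorem injective_id_add_smulRight {ℓ : Dual ℂ E} (u : LinearMap.ker ℓ) :
    Function.Injective (LinearMap.id + ℓ.smulRight (u : E) : E →ₗ[ℂ] E) := by
  intro v w h
  have hu : ℓ u = 0 := u.2
  have h' : v + ℓ v • (u : E) = w + ℓ w • (u : E) := by simpa using h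
  have hℓ : ℓ v = ℓ w := by simpa [hu] using congrArg ℓ h'
  simpa [hℓ] using h'

/-- The point `[v + ℓ(v) u]` associated with the point `[v]`, for `u` in the kernel of `ℓ`. -/
def transvect (ℓ : Dual ℂ E) (u : LinearMap.ker ℓ) (p : Projectivization ℂ E) :
    Projectivization ℂ E :=
  Projectivization.map (LinearMap.id + ℓ.smulRight (u : E)) (injective_id_add_smulRight u) p

theorem add_smul_ne_zero {ℓ : Dual ℂ E} (u : LinearMap.ker ℓ) {v : E} (hv : v ≠ 0) :
    v + ℓ v • (u : E) ≠ 0 := by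
  intro h
  have hu : ℓ u = 0 := u.2
  have hℓ : ℓ v = 0 := by simpa [hu] using congrArg ℓ h
  simp [hℓ, hv] at h

theorem transvect_mk (ℓ : Dual ℂ E) (u : LinearMap.ker ℓ) (v : E) (hv : v ≠ 0) :
    transvect ℓ u (mk ℂ v hv) = mk ℂ (v + ℓ v • (u : E)) (add_smul_ne_zero u hv) := by
  rw [transvect, map_mk]
  simp

theorem transvect_neg_transvect (ℓ : Dual ℂ E) (u : LinearMap.ker ℓ)
    (p : Projectivization ℂ E) : transvect ℓ u (transvect ℓ (-u) p) = p := by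
  induction p with
  | h v hv =>
    have hu : ℓ u = 0 := u.2
    rw [transvect_mk, transvect_mk]
    simp [hu]

theorem continuous_transvect [FiniteDimensional ℂ E] (ℓ : Dual ℂ E) :
    Continuous fun z : LinearMap.ker ℓ × Projectivization ℂ E => transvect ℓ z.1 z.2 := by
  have hq : IsOpenQuotientMap (Prod.map id (mk' ℂ) :
      LinearMap.ker ℓ × {v : E // v ≠ 0} → LinearMap.ker ℓ × Projectivization ℂ E) :=
    IsOpenQuotientMap.id.prodMap isOpenQuotientMap_mk'
  rw [hq.isQuotientMap.continuous_iff]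
  have : ((fun z : LinearMap.ker ℓ × Projectivization ℂ E => transvect ℓ z.1 z.2) ∘
      Prod.map id (mk' ℂ)) = fun z : LinearMap.ker ℓ × {v : E // v ≠ 0} =>
        mk ℂ (z.2.1 + ℓ z.2.1 • (z.1 : E)) (add_smul_ne_zero z.1 z.2.2) :=
    funext fun z => transvect_mk ℓ z.1 z.2.1 z.2.2
  rw [this]
  have hℓ : Continuous ℓ := ℓ.continuous_of_finiteDimensional
  exact continuous_mk (by fun_prop) _

theorem continuous_coordinate {κ : Type*} (S : Set (κ → Projectivization ℂ E)) (j : κ) :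
    Continuous fun x : S => x.1 j :=
  (continuous_apply j).comp continuous_subtype_val

theorem exists_mem_indepConf [FiniteDimensional ℂ E] {K : Submodule ℂ E} {m : ℕ}
    (h : finrank ℂ K + m ≤ finrank ℂ E) : (indepConf E K m).Nonempty := by
  have hq : m ≤ finrank ℂ (E ⧸ K) := by
    have := K.finrank_quotient_add_finrank
    omega
  let b := finBasis ℂ (E ⧸ K)
  choose s hs using K.mkQ_surjective
  refine ⟨_, mk_mem_indepConf (v := fun j : Fin m => s (b (Fin.castLE hq j))) fun c hc => ?_⟩
  have hli := b.linearIndependent.comp _ (Fin.castLE_injective hq)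
  rw [Fintype.linearIndependent_iff] at hli
  funext j
  refine hli c ?_ j
  rw [← Submodule.Quotient.mk_eq_zero, ← Submodule.mkQ_apply] at hc
  simpa only [map_sum, map_smul, hs, Function.comp_apply] using hc

theorem lineGeneric_indepMod [FiniteDimensional ℂ E] (K : Submodule ℂ E) (m : ℕ) :
    LineGeneric {v : Fin m → E | IndepMod K v} := by
  simp only [indepMod_iff_exists_det_ne_zero]
  refine LineGeneric.of_exists_ne_zero _ fun q => Differentiable.matrix_det fun a b => ?_
  exact ((LinearMap.proj a ∘ₗ q.1 ∘ₗ LinearMap.proj b :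
    (Fin m → E) →ₗ[ℂ] ℂ).toContinuousLinearMap).differentiable

theorem isPathConnected_indepConf_chart_inter [FiniteDimensional ℂ E] {K : Submodule ℂ E} {m : ℕ}
    (ℓ ℓ' : Dual ℂ E) (x₀ : indepConf E K (m + 1)) (h₀ : ℓ (x₀.1 0).rep ≠ 0)
    (h₀' : ℓ' (x₀.1 0).rep ≠ 0) :
    IsPathConnected ({x : indepConf E K (m + 1) | ℓ (x.1 0).rep ≠ 0} ∩
      {x : indepConf E K (m + 1) | ℓ' (x.1 0).rep ≠ 0}) := by
  have hgen : ∀ f : Dual ℂ E, LineGeneric {v : Fin (m + 1) → E | f (v 0) ≠ 0} := fun f =>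
    LineGeneric.of_ne_zero _
      ((f ∘ₗ LinearMap.proj 0 : (Fin (m + 1) → E) →ₗ[ℂ] ℂ).toContinuousLinearMap).differentiable
  have hO := ((lineGeneric_indepMod K (m + 1)).inter ((hgen ℓ).inter (hgen ℓ'))).isPathConnected
    ⟨fun j => (x₀.1 j).rep, x₀.2, h₀, h₀'⟩
  rw [isPathConnected_iff_pathConnectedSpace] at hO
  set O := {v : Fin (m + 1) → E | IndepMod K v} ∩
    ({v | ℓ (v 0) ≠ 0} ∩ {v | ℓ' (v 0) ≠ 0})
  let g : O → indepConf E K (m + 1) := fun v => ⟨_, mk_mem_indepConf v.2.1⟩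
  have hg : Continuous g := by
    refine Continuous.subtype_mk (continuous_pi fun j => ?_) _
    exact continuous_mk ((continuous_apply j).comp continuous_subtype_val) _
  convert isPathConnected_range hg
  ext x
  constructor
  · rintro ⟨h, h'⟩
    exact ⟨⟨fun j => (x.1 j).rep, x.2, h, h'⟩, Subtype.ext (funext fun j => mk_rep _)⟩
  · rintro ⟨v, rfl⟩
    exact ⟨(apply_rep_mk_ne_zero_iff ℓ _ _).2 v.2.2.1,
      (apply_rep_mk_ne_zero_iff ℓ' _ _).2 v.2.2.2⟩

theorem cons_transvect_mem_indepConf {m : ℕ} {K : Submodule ℂ E} {ℓ : Dual ℂ E}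
    (hK : K ≤ LinearMap.ker ℓ) {e : E} (he : ℓ e = 1) (u : LinearMap.ker ℓ) (hne : e + (u : E) ≠ 0)
    {x : Fin m → Projectivization ℂ E} (hx : x ∈ indepConf E (K ⊔ ℂ ∙ e) m) :
    (Fin.cons (mk ℂ (e + u) hne) fun j => transvect ℓ u (x j) :
      Fin (m + 1) → Projectivization ℂ E) ∈ indepConf E K (m + 1) := by
  have h := IndepMod.cons_transvection hK he u.2 hx
  convert mk_mem_indepConf h with j
  refine Fin.cases rfl (fun j => ?_) j
  simp only [Fin.cons_succ]
  conv_lhs => rw [← mk_rep (x j), transvect_mk]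

theorem tail_transvect_mem_indepConf {m : ℕ} {K : Submodule ℂ E} {ℓ : Dual ℂ E}
    (hK : K ≤ LinearMap.ker ℓ) {e : E} (he : ℓ e = 1) (u : LinearMap.ker ℓ)
    {x : Fin (m + 1) → Projectivization ℂ E} (hx : x ∈ indepConf E K (m + 1))
    (h0 : ℓ (x 0).rep ≠ 0) (hu : normalize ℓ (x 0) = e + u) :
    (fun j : Fin m => transvect ℓ (-u) (x j.succ)) ∈ indepConf E (K ⊔ ℂ ∙ e) m := by
  have hx' : IndepMod K (Fin.cons (normalize ℓ (x 0)) fun j => (x j.succ).rep :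
      Fin (m + 1) → E) := by
    refine IndepMod.of_mk_eq (Fin.cases (by simpa using normalize_ne_zero ℓ h0)
      fun j => by simpa using rep_nonzero _) hx (Fin.cases ?_ fun j => ?_)
    · simp only [Fin.cons_zero, mk_normalize ℓ h0, mk_rep]
    · simp only [Fin.cons_succ]
  have h := IndepMod.tail_transvection hK he u.2 hx' (by simpa using hu)
  convert mk_mem_indepConf h with j
  conv_lhs => rw [← mk_rep (x j.succ), transvect_mk]
  simp [sub_eq_add_neg]

theorem simplyConnectedSpace_indepConf [FiniteDimensional ℂ E] (m : ℕ) (K : Submodule ℂ E)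
    (h : finrank ℂ K + m ≤ finrank ℂ E) : SimplyConnectedSpace (indepConf E K m) := by
  induction m generalizing K with
  | zero =>
    have : Unique (indepConf E K 0) :=
      { default := ⟨Fin.elim0, fun c _ => Subsingleton.elim _ _⟩
        uniq := fun x => Subtype.ext (Subsingleton.elim _ _) }
    infer_instance
  | succ m ih =>
    obtain ⟨x₀, hx₀⟩ := exists_mem_indepConf h
    refine simplyConnectedSpace_of_open_cover (⟨x₀, hx₀⟩ : indepConf E K (m + 1))
      {U | ∃ ℓ : Dual ℂ E, K ≤ LinearMap.ker ℓ ∧ ℓ (x₀ 0).rep ≠ 0 ∧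
        U = {x | ℓ (x.1 0).rep ≠ 0}} ?_ ?_ ?_ ?_ ?_
    · rintro _ ⟨ℓ, -, -, rfl⟩
      exact (isOpen_setOf_apply_rep_ne_zero ℓ).preimage
        (continuous_coordinate (indepConf E K (m + 1)) 0)
    · intro x
      obtain ⟨f, hf⟩ := Module.exists_dual_forall_apply_ne_zero (K := ℂ)
        ![K.mkQ (x.1 0).rep, K.mkQ (x₀ 0).rep] (fun j => by
          fin_cases j
          · simpa using IndepMod.notMem x.2 0
          · simpa using IndepMod.notMem hx₀ 0)
      refine ⟨_, ⟨f ∘ₗ K.mkQ, ?_, ?_, rfl⟩, ?_⟩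
      · intro y hy
        simp [(Submodule.Quotient.mk_eq_zero K).2 hy]
      · simpa using hf 1
      · simpa using hf 0
    · rintro _ ⟨ℓ, -, h0, rfl⟩
      exact h0
    · rintro _ ⟨ℓ, -, h0, rfl⟩ _ ⟨ℓ', -, h0', rfl⟩
      exact isPathConnected_indepConf_chart_inter ℓ ℓ' ⟨x₀, hx₀⟩ h0 h0'
    · rintro _ ⟨ℓ, hK, h0, rfl⟩ x y p q hp hq
      let e : E := normalize ℓ (x₀ 0)
      have he : ℓ e = 1 := apply_normalize ℓ h0
      have hSC : SimplyConnectedSpace (indepConf E (K ⊔ ℂ ∙ e) m) := by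
        refine ih _ ?_
        have h1 := Submodule.finrank_add_le_finrank_add_finrank K (ℂ ∙ e)
        have h2 := finrank_span_le_card (R := ℂ) ({e} : Set E)
        simp at h2
        omega
      have hne : ∀ u : LinearMap.ker ℓ, e + (u : E) ≠ 0 := fun u hu => by
        have hu' : ℓ u = 0 := u.2
        simpa [he, hu'] using congrArg ℓ hu
      let Φ : LinearMap.ker ℓ × indepConf E (K ⊔ ℂ ∙ e) m → indepConf E K (m + 1) := fun z =>
        ⟨_, cons_transvect_mem_indepConf hK he z.1 (hne z.1) z.2.2⟩
      have hΦ : Continuous Φ := by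
        refine Continuous.subtype_mk (continuous_pi (Fin.cases ?_ fun j => ?_)) _
        · simp only [Fin.cons_zero]
          exact continuous_mk (by fun_prop) _
        · simp only [Fin.cons_succ]
          exact (continuous_transvect ℓ).comp
            (continuous_fst.prodMk ((continuous_coordinate _ j).comp continuous_snd))
      let υ : {x : indepConf E K (m + 1) | ℓ (x.1 0).rep ≠ 0} → LinearMap.ker ℓ := fun x =>
        ⟨normalize ℓ (x.1.1 0) - e, by
          rw [LinearMap.mem_ker, map_sub, he, apply_normalize ℓ x.2, sub_self]⟩
      have hυ : Continuous υ := by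
        refine Continuous.subtype_mk (Continuous.sub ?_ continuous_const) _
        exact (continuousOn_normalize ℓ).comp_continuous
          ((continuous_coordinate _ 0).comp continuous_subtype_val) fun x => x.2
      let Ψ : {x : indepConf E K (m + 1) | ℓ (x.1 0).rep ≠ 0} →
          LinearMap.ker ℓ × indepConf E (K ⊔ ℂ ∙ e) m := fun x =>
        (υ x, ⟨_, tail_transvect_mem_indepConf hK he (υ x) x.1.2 x.2 (by simp [υ])⟩)
      have hΨ : Continuous Ψ := by
        refine hυ.prodMk (Continuous.subtype_mk (continuous_pi fun j => ?_) _)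
        exact (continuous_transvect ℓ).comp (hυ.neg.prodMk
          ((continuous_coordinate _ j.succ).comp continuous_subtype_val))
      have := SimplyConnectedSpace.prod (X := LinearMap.ker ℓ) (Y := indepConf E (K ⊔ ℂ ∙ e) m)
      refine homotopic_of_factor Φ hΦ Ψ hΨ (fun z => Subtype.ext (funext ?_)) x y p q hp hq
      refine Fin.cases ?_ fun j => ?_
      · have : e + (υ z : E) = normalize ℓ (z.1.1 0) := by simp [υ]
        simp only [Φ, Ψ, Fin.cons_zero, this, mk_normalize ℓ z.2]
      · simp only [Φ, Ψ, Fin.cons_succ, transvect_neg_transvect]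

end IndependentPoints

section SpreadMatrices

/-- Matrices with independent rows and pairwise independent columns. -/
def spreadMatrices (r k : ℕ) : Set (Fin r → Fin k → ℂ) :=
  {B | LinearIndependent ℂ B ∧
    ∀ a b, a ≠ b → LinearIndependent ℂ ![fun t => B t a, fun t => B t b]}

theorem isThin_setOf_eq_sum {V : Type*} [NormedAddCommGroup V] [NormedSpace ℝ V] {r k : ℕ}
    {κ : Type*} [Fintype κ] (T : V ≃L[ℝ] (Fin r → Fin k → ℂ)) (b : Fin r) (s : κ → {j // j ≠ b})
    (hdim : Fintype.card κ + 2 ≤ k) :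
    IsThin {x : V | ∃ c : κ → ℂ, T x b = ∑ t, c t • T x (s t)} := by
  let h : ({j : Fin r // j ≠ b} → Fin k → ℂ) × (κ → ℂ) → Fin r → Fin k → ℂ := fun z j =>
    if hj : j = b then ∑ t, z.2 t • z.1 (s t) else z.1 ⟨j, hj⟩
  have hh : ContDiff ℝ 1 h := by
    rw [contDiff_pi]
    intro j
    by_cases hj : j = b
    · simp only [h, hj, dite_true]
      fun_prop
    · simp only [h, hj, dite_false]
      fun_prop
  refine IsThin.of_subset_range (T.symm ∘ h) (T.symm.contDiff.comp hh) ?_ ?_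
  · rintro x ⟨c, hc⟩
    refine ⟨(fun j => T x j, c), ?_⟩
    rw [Function.comp_apply, T.symm_apply_eq]
    funext j
    by_cases hj : j = b
    · subst hj
      simp [h, hc]
    · simp [h, hj]
  · have hr : 0 < r := b.pos
    rw [T.toLinearEquiv.finrank_eq]
    simp only [Module.finrank_prod, Module.finrank_pi_fintype, Complex.finrank_real_complex,
      Finset.sum_const, Finset.card_univ, Fintype.card_fin, smul_eq_mul, ne_eq,
      Fintype.card_subtype_compl, Fintype.card_unique]
    obtain ⟨r, rfl⟩ := Nat.exists_eq_add_one.2 hr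
    simp only [Nat.add_sub_cancel]
    nlinarith

/-- Transposition of matrices as a continuous linear equivalence. -/
def transposeEquiv (r k : ℕ) : (Fin r → Fin k → ℂ) ≃L[ℝ] (Fin k → Fin r → ℂ) :=
  LinearEquiv.toContinuousLinearEquiv
    { toFun := fun B a t => B t a
      invFun := fun B t a => B a t
      map_add' := fun _ _ => rfl
      map_smul' := fun _ _ => rfl }

theorem isThin_spreadMatrices_compl {r k : ℕ} (hr : 3 ≤ r) (hk : r + 1 ≤ k) :
    IsThin (spreadMatrices r k)ᶜ := by
  have : NeZero r := ⟨by omega⟩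
  have : NeZero k := ⟨by omega⟩
  have hrow := IsThin.iUnion fun b : Fin r => isThin_setOf_eq_sum (k := k)
    (ContinuousLinearEquiv.refl ℝ (Fin r → Fin k → ℂ)) b id (by simp; omega)
  have hcol := IsThin.iUnion fun p : {p : Fin k × Fin k // p.1 ≠ p.2} => isThin_setOf_eq_sum
    (transposeEquiv r k) p.1.2 (fun _ : Unit => ⟨p.1.1, p.2⟩) (by simp; omega)
  have hcol' : ∀ (B : Fin r → Fin k → ℂ) (a b : Fin k) (c : ℂ), a ≠ b →
      (c • fun t => B t a) = (fun t => B t b) → B ∈ ⋃ p : {p : Fin k × Fin k // p.1 ≠ p.2},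
        {x | ∃ c : Unit → ℂ, transposeEquiv r k x p.1.2 =
          ∑ t, c t • transposeEquiv r k x p.1.1} := by
    intro B a b c hab h
    refine mem_iUnion.2 ⟨⟨(a, b), hab⟩, fun _ => c, ?_⟩
    rw [Fintype.sum_unique]
    exact h.symm
  intro x y
  refine lt_of_le_of_lt (dimH_mono ?_) (hrow.union hcol x y)
  rintro z ⟨s, t, B, hB, rfl⟩
  refine ⟨s, t, B, ?_, rfl⟩
  by_cases hli : LinearIndependent ℂ B
  · right
    have : ∃ a b, a ≠ b ∧ ¬ LinearIndependent ℂ ![fun t => B t a, fun t => B t b] := by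
      by_contra! h
      exact hB ⟨hli, h⟩
    obtain ⟨a, b, hab, h⟩ := this
    by_cases ha : (fun t => B t a) = 0
    · exact hcol' B b a 0 hab.symm (by rw [ha, zero_smul])
    · rw [LinearIndependent.pair_iff' ha] at h
      push Not at h
      obtain ⟨c, hc⟩ := h
      exact hcol' B a b c hab hc
  · left
    rw [Fintype.not_linearIndependent_iff] at hli
    obtain ⟨g, hg, b, hb⟩ := hli
    refine mem_iUnion.2 ⟨b, fun j => -(g b)⁻¹ * g j, ?_⟩
    rw [← Finset.add_sum_erase _ _ (Finset.mem_univ b)] at hg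
    have hsum : ∑ j : {j // j ≠ b}, g j • B j = ∑ j ∈ Finset.univ.erase b, g j • B j :=
      (Finset.sum_subtype _ (by simp) fun j => g j • B j).symm
    rw [← hsum] at hg
    have h1 : g b • B b = -∑ j : {j // j ≠ b}, g j • B j := eq_neg_of_add_eq_zero_left hg
    simp only [ContinuousLinearEquiv.refl_apply, id_eq, mul_smul, ← Finset.smul_sum]
    rw [neg_smul, ← smul_neg, ← h1, inv_smul_smul₀ hb]

theorem isOpen_spreadMatrices (r k : ℕ) : IsOpen (spreadMatrices r k) := by
  have : spreadMatrices r k = {B | LinearIndependent ℂ B} ∩ ⋂ a, ⋂ b, ⋂ _ : a ≠ b,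
      {B : Fin r → Fin k → ℂ | LinearIndependent ℂ ![fun t => B t a, fun t => B t b]} := by
    ext B
    simp [spreadMatrices]
  rw [this]
  refine isOpen_setOfPred_linearIndependent.inter (isOpen_iInter_of_finite fun a =>
    isOpen_iInter_of_finite fun b => isOpen_iInter_of_finite fun _ => ?_)
  refine isOpen_setOfPred_linearIndependent.preimage (f := fun B : Fin r → Fin k → ℂ =>
    ![fun t => B t a, fun t => B t b]) (continuous_pi fun j => ?_)
  fin_cases j
  · simp only [Fin.zero_eta, Matrix.cons_val_zero]
    fun_prop
  · simp only [Fin.mk_one, Matrix.cons_val_one]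
    fun_prop

theorem simplyConnectedSpace_spreadMatrices {r k : ℕ} (hr : 3 ≤ r) (hk : r + 1 ≤ k) :
    SimplyConnectedSpace (spreadMatrices r k) := by
  have : NeZero r := ⟨by omega⟩
  have : NeZero k := ⟨by omega⟩
  have h := (isThin_spreadMatrices_compl hr hk).simplyConnectedSpace_compl
    (isOpen_spreadMatrices r k).isClosed_compl
  rwa [compl_compl] at h

end SpreadMatrices

section Configurations

open Projectivization Matrix

theorem linearIndependent_rows_iff {r k : ℕ} {w : Fin k → Fin r → ℂ} :
    LinearIndependent ℂ (fun t j => w j t) ↔ ∀ y, (∀ j, y ⬝ᵥ w j = 0) → y = 0 := by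
  rw [Fintype.linearIndependent_iff]
  refine forall_congr' fun y => ?_
  simp only [funext_iff, Finset.sum_apply, Pi.smul_apply, smul_eq_mul, Pi.zero_apply, dotProduct]

theorem span_range_col_eq_top {r k : ℕ} {B : Fin r → Fin k → ℂ} (h : LinearIndependent ℂ B) :
    span ℂ (range fun j t => B t j) = ⊤ := by
  have h1 : (Matrix.of B).rank = Fintype.card (Fin r) := LinearIndependent.rank_matrix h
  rw [Matrix.rank_eq_finrank_span_cols] at h1
  exact Submodule.eq_top_of_finrank_eq (h1.trans (by simp))

open scoped ComplexOrder in
theorem det_mul_conjTranspose_ne_zero {r k : ℕ} {B : Matrix (Fin r) (Fin k) ℂ}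
    (h : LinearIndependent ℂ B.row) : (B * Bᴴ).det ≠ 0 := by
  intro h0
  obtain ⟨v, hv, hv0⟩ := Matrix.exists_mulVec_eq_zero_iff.2 h0
  rw [Matrix.self_mul_conjTranspose_mulVec_eq_zero] at hv0
  have h1 := congrArg star hv0
  rw [Matrix.star_mulVec, Matrix.conjTranspose_conjTranspose, star_zero] at h1
  have h2 := Matrix.vecMul_injective_iff.2 h (h1.trans (Matrix.zero_vecMul B).symm)
  exact hv (star_eq_zero.1 h2)

variable {i k n : ℕ}

theorem mk_mem_Fconf_iff {v : Fin k → Fin (n + 1) → ℂ} (hv : ∀ j, v j ≠ 0) :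
    (fun j => mk ℂ (v j) (hv j)) ∈ Fconf k i n ↔
      (∀ a b, a ≠ b → LinearIndependent ℂ ![v a, v b]) ∧
        finrank ℂ (span ℂ (range v)) = i + 1 := by
  have hspan : span ℂ (range fun j => (mk ℂ (v j) (hv j)).rep) = span ℂ (range v) := by
    choose c hc using fun j => exists_smul_eq_mk_rep ℂ (v j) (hv j)
    refine le_antisymm (span_le.2 ?_) (span_le.2 ?_)
    · rintro _ ⟨j, rfl⟩
      change (mk ℂ (v j) (hv j)).rep ∈ _
      rw [← hc j]
      exact Submodule.smul_mem _ _ (subset_span ⟨j, rfl⟩)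
    · rintro _ ⟨j, rfl⟩
      have : v j = (c j)⁻¹ • (mk ℂ (v j) (hv j)).rep := by rw [← hc j, inv_smul_smul]
      rw [this]
      exact Submodule.smul_mem _ _ (subset_span ⟨j, rfl⟩)
  rw [Fconf, mem_ofPred_eq, hspan]
  refine and_congr_left fun _ => ?_
  simp only [← independent_mk_iff_LinearIndependent (hv _) (hv _), independent_pair_iff_ne]
  exact ⟨fun h a b hab h' => hab (h h'), fun h a b hab => by_contra fun h' => h a b h' hab⟩

theorem linearIndependent_rows_rep_mk_iff {r : ℕ} (P : Matrix (Fin r) (Fin (n + 1)) ℂ)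
    {v : Fin k → Fin (n + 1) → ℂ} (hv : ∀ j, v j ≠ 0) :
    LinearIndependent ℂ (fun t j => (P *ᵥ (mk ℂ (v j) (hv j)).rep) t) ↔
      LinearIndependent ℂ (fun t j => (P *ᵥ v j) t) := by
  choose c hc using fun j => exists_smul_eq_mk_rep ℂ (v j) (hv j)
  rw [linearIndependent_rows_iff, linearIndependent_rows_iff]
  refine forall_congr' fun y => imp_congr_left (forall_congr' fun j => ?_)
  rw [← hc j, Units.smul_def, Matrix.mulVec_smul, dotProduct_smul, smul_eq_mul]
  simp

/-- A linear map that is injective on the span of the `v j` can be inverted there. -/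
theorem exists_mul_eq_one_and_mulVec_eq {r : ℕ} {P : Matrix (Fin r) (Fin (n + 1)) ℂ}
    {v : Fin k → Fin (n + 1) → ℂ} (hv : finrank ℂ (span ℂ (range v)) = r)
    (hP : LinearIndependent ℂ fun t j => (P *ᵥ v j) t) :
    ∃ A : Matrix (Fin (n + 1)) (Fin r) ℂ, P * A = 1 ∧ ∀ j, A *ᵥ (P *ᵥ v j) = v j := by
  set S := span ℂ (range v)
  let p : S →ₗ[ℂ] Fin r → ℂ := P.mulVecLin.domRestrict S
  have hvS : ∀ j, v j ∈ S := fun j => subset_span ⟨j, rfl⟩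
  have hsurj : Function.Surjective p := by
    rw [← LinearMap.range_eq_top, ← top_le_iff, ← span_range_col_eq_top hP, span_le]
    rintro _ ⟨j, rfl⟩
    exact ⟨⟨v j, hvS j⟩, rfl⟩
  have hinj : Function.Injective p :=
    (LinearMap.injective_iff_surjective_of_finrank_eq_finrank (by simpa using hv)).2 hsurj
  let e := LinearEquiv.ofBijective p ⟨hinj, hsurj⟩
  let a : (Fin r → ℂ) →ₗ[ℂ] Fin (n + 1) → ℂ := S.subtype ∘ₗ e.symm.toLinearMap
  refine ⟨LinearMap.toMatrix' a, ?_, fun j => ?_⟩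
  · apply Matrix.toLin'.injective
    rw [Matrix.toLin'_mul, Matrix.toLin'_toMatrix', Matrix.toLin'_one]
    ext1 y
    exact LinearMap.ext fun z => e.apply_symm_apply _
  · rw [LinearMap.toMatrix'_mulVec]
    have : P *ᵥ v j = e ⟨v j, hvS j⟩ := rfl
    simp [a, this]

theorem eq_zero_of_mulVec_eq_zero_of_isUnit_det {r : ℕ} {P : Matrix (Fin r) (Fin (n + 1)) ℂ}
    {A : Matrix (Fin (n + 1)) (Fin r) ℂ} (h : IsUnit (P * A).det) (y : Fin r → ℂ)
    (hy : A *ᵥ y = 0) : y = 0 := by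
  refine Matrix.eq_zero_of_mulVec_eq_zero h.ne_zero ?_
  rw [← Matrix.mulVec_mulVec, hy, Matrix.mulVec_zero]

theorem col_ne_zero (hk : 2 ≤ k) {r : ℕ} {B : Fin r → Fin k → ℂ} (hB : B ∈ spreadMatrices r k)
    (j : Fin k) : (fun t => B t j) ≠ 0 := by
  have : Nontrivial (Fin k) := Fin.nontrivial_iff_two_le.2 hk
  obtain ⟨b, hb⟩ := exists_ne j
  exact (hB.2 j b hb.symm).ne_zero 0

theorem mk_mulVec_mem_Fconf {A : Matrix (Fin (n + 1)) (Fin (i + 1)) ℂ}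
    (hA : ∀ y, A *ᵥ y = 0 → y = 0) {B : Fin (i + 1) → Fin k → ℂ}
    (hB : B ∈ spreadMatrices (i + 1) k) (hne : ∀ j, (A *ᵥ fun t => B t j) ≠ 0) :
    (fun j => mk ℂ (A *ᵥ fun t => B t j) (hne j)) ∈ Fconf k i n := by
  have hker : LinearMap.ker A.mulVecLin = ⊥ := LinearMap.ker_eq_bot'.2 hA
  rw [mk_mem_Fconf_iff]
  constructor
  · intro a b hab
    have : ![A *ᵥ fun t => B t a, A *ᵥ fun t => B t b] =
        A.mulVecLin ∘ ![fun t => B t a, fun t => B t b] := by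
      funext c
      fin_cases c <;> rfl
    rw [this]
    exact (hB.2 a b hab).map' A.mulVecLin hker
  · have : (range fun j => A *ᵥ fun t => B t j) = A.mulVecLin '' range fun j t => B t j := by
      rw [← range_comp]
      rfl
    rw [this, span_image, span_range_col_eq_top hB.1, Submodule.map_top,
      LinearMap.finrank_range_of_inj (LinearMap.ker_eq_bot.1 hker)]
    simp

theorem LineGeneric.preimage {W W' : Type*} [NormedAddCommGroup W] [NormedSpace ℂ W]
    [NormedAddCommGroup W'] [NormedSpace ℂ W'] {O : Set W'} (h : LineGeneric O)
    (L : W →ₗ[ℂ] W') : LineGeneric (L ⁻¹' O) := by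
  intro x hx y hy
  refine (h _ hx _ hy).mono fun z hz => ?_
  simpa [AffineMap.lineMap_apply_module'] using hz

theorem indepMod_bot_iff {E : Type*} [NormedAddCommGroup E] [NormedSpace ℂ E] {m : ℕ}
    {v : Fin m → E} : IndepMod ⊥ v ↔ LinearIndependent ℂ v := by
  rw [Fintype.linearIndependent_iff]
  simp [IndepMod, funext_iff]

theorem lineGeneric_linearIndependent (E : Type*) [NormedAddCommGroup E] [NormedSpace ℂ E]
    [FiniteDimensional ℂ E] (m : ℕ) : LineGeneric {v : Fin m → E | LinearIndependent ℂ v} := by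
  simpa only [indepMod_bot_iff] using lineGeneric_indepMod (⊥ : Submodule ℂ E) m

theorem lineGeneric_spreadMatrices (r k : ℕ) : LineGeneric (spreadMatrices r k) := by
  have hpair : ∀ p : {p : Fin k × Fin k // p.1 ≠ p.2}, LineGeneric {B : Fin r → Fin k → ℂ |
      LinearIndependent ℂ ![fun t => B t p.1.1, fun t => B t p.1.2]} := by
    intro p
    let L : (Fin r → Fin k → ℂ) →ₗ[ℂ] Fin 2 → Fin r → ℂ :=
      { toFun := fun B c t => B t (![p.1.1, p.1.2] c)
        map_add' := fun _ _ => rfl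
        map_smul' := fun _ _ => rfl }
    convert (lineGeneric_linearIndependent (Fin r → ℂ) 2).preimage L using 1
    ext B
    have : L B = ![fun t => B t p.1.1, fun t => B t p.1.2] := by
      funext c
      fin_cases c <;> rfl
    rw [mem_preimage, this, mem_ofPred_eq, mem_ofPred_eq]
  have : spreadMatrices r k = {B | LinearIndependent ℂ B} ∩
      ⋂ p : {p : Fin k × Fin k // p.1 ≠ p.2}, {B : Fin r → Fin k → ℂ |
        LinearIndependent ℂ ![fun t => B t p.1.1, fun t => B t p.1.2]} := by
    ext B
    simp [spreadMatrices]
  rw [this]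
  exact (lineGeneric_linearIndependent (Fin k → ℂ) r).inter (LineGeneric.iInter hpair)

theorem mem_spreadMatrices_of_mulVec_eq {r : ℕ} {P : Matrix (Fin r) (Fin (n + 1)) ℂ}
    {A : Matrix (Fin (n + 1)) (Fin r) ℂ} {v : Fin k → Fin (n + 1) → ℂ}
    (hv : ∀ a b, a ≠ b → LinearIndependent ℂ ![v a, v b])
    (hP : LinearIndependent ℂ fun t j => (P *ᵥ v j) t) (hA : ∀ j, A *ᵥ (P *ᵥ v j) = v j) :
    (fun t j => (P *ᵥ v j) t) ∈ spreadMatrices r k := by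
  refine ⟨hP, fun a b hab => LinearIndependent.of_comp A.mulVecLin ?_⟩
  have : A.mulVecLin ∘ ![P *ᵥ v a, P *ᵥ v b] = ![v a, v b] := by
    funext c
    fin_cases c
    · exact hA a
    · exact hA b
  rw [this]
  exact hv a b hab

variable (k) in
/-- The configurations avoiding the hyperplane `f = 0` whose span is mapped isomorphically
by `P`. -/
def confChart (P : Matrix (Fin (i + 1)) (Fin (n + 1)) ℂ) (f : Dual ℂ (Fin (n + 1) → ℂ)) :
    Set (Fconf k i n) :=
  {x | (∀ j, f (x.1 j).rep ≠ 0) ∧ LinearIndependent ℂ fun t j => (P *ᵥ (x.1 j).rep) t}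

theorem mk_mem_confChart_iff {P : Matrix (Fin (i + 1)) (Fin (n + 1)) ℂ}
    {f : Dual ℂ (Fin (n + 1) → ℂ)} {v : Fin k → Fin (n + 1) → ℂ} {hv : ∀ j, v j ≠ 0}
    {hmem : (fun j => mk ℂ (v j) (hv j)) ∈ Fconf k i n} :
    ⟨fun j => mk ℂ (v j) (hv j), hmem⟩ ∈ confChart k P f ↔
      (∀ j, f (v j) ≠ 0) ∧ LinearIndependent ℂ fun t j => (P *ᵥ v j) t :=
  and_congr (forall_congr' fun j => apply_rep_mk_ne_zero_iff f (v j) (hv j))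
    (linearIndependent_rows_rep_mk_iff P hv)

theorem mem_confChart_iff_normalize {P : Matrix (Fin (i + 1)) (Fin (n + 1)) ℂ}
    {f : Dual ℂ (Fin (n + 1) → ℂ)} {x : Fconf k i n} :
    x ∈ confChart k P f ↔ (∀ j, f (x.1 j).rep ≠ 0) ∧
      LinearIndependent ℂ fun t j => (P *ᵥ normalize f (x.1 j)) t := by
  refine and_congr_right fun hf => ?_
  rw [← linearIndependent_rows_rep_mk_iff P fun j => normalize_ne_zero f (hf j)]
  simp only [mk_normalize f (hf _)]

theorem continuousOn_normalize_coordinate (f : Dual ℂ (Fin (n + 1) → ℂ)) (j : Fin k) :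
    ContinuousOn (fun x : Fconf k i n => normalize f (x.1 j)) {x | ∀ j, f (x.1 j).rep ≠ 0} :=
  (continuousOn_normalize f).comp (continuous_coordinate _ j).continuousOn fun _ hx => hx j

theorem isOpen_confChart (P : Matrix (Fin (i + 1)) (Fin (n + 1)) ℂ)
    (f : Dual ℂ (Fin (n + 1) → ℂ)) : IsOpen (confChart k P f) := by
  have hO : IsOpen {x : Fconf k i n | ∀ j, f (x.1 j).rep ≠ 0} := by
    rw [ofPred_forall]
    exact isOpen_iInter_of_finite fun j =>
      (isOpen_setOf_apply_rep_ne_zero f).preimage (continuous_coordinate _ j)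
  have hcont : ContinuousOn (fun (x : Fconf k i n) (t : Fin (i + 1)) (j : Fin k) =>
      (P *ᵥ normalize f (x.1 j)) t) {x | ∀ j, f (x.1 j).rep ≠ 0} := by
    refine continuousOn_pi.2 fun t => continuousOn_pi.2 fun j => ?_
    exact (Continuous.comp (g := fun v : Fin (n + 1) → ℂ => (P *ᵥ v) t) (by fun_prop)
      continuous_id).comp_continuousOn (continuousOn_normalize_coordinate f j)
  have : confChart k P f = {x : Fconf k i n | ∀ j, f (x.1 j).rep ≠ 0} ∩
      (fun (x : Fconf k i n) (t : Fin (i + 1)) (j : Fin k) =>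
        (P *ᵥ normalize f (x.1 j)) t) ⁻¹' {B | LinearIndependent ℂ B} :=
    Set.ext fun x => mem_confChart_iff_normalize
  rw [this]
  exact hcont.isOpen_inter_preimage hO isOpen_setOfPred_linearIndependent

theorem exists_frame {P : Matrix (Fin (i + 1)) (Fin (n + 1)) ℂ} {f : Dual ℂ (Fin (n + 1) → ℂ)}
    {x : Fconf k i n} (hx : x ∈ confChart k P f) :
    ∃ A : Matrix (Fin (n + 1)) (Fin (i + 1)) ℂ, P * A = 1 ∧
      (∀ j, A *ᵥ (P *ᵥ normalize f (x.1 j)) = normalize f (x.1 j)) ∧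
      (fun t j => (P *ᵥ normalize f (x.1 j)) t) ∈ spreadMatrices (i + 1) k := by
  obtain ⟨hf, hP⟩ := mem_confChart_iff_normalize.1 hx
  have hmem : (fun j => mk ℂ (normalize f (x.1 j)) (normalize_ne_zero f (hf j))) ∈
      Fconf k i n := by
    simpa only [mk_normalize f (hf _)] using x.2
  rw [mk_mem_Fconf_iff] at hmem
  obtain ⟨A, hA, hA'⟩ := exists_mul_eq_one_and_mulVec_eq hmem.2 hP
  exact ⟨A, hA, hA', mem_spreadMatrices_of_mulVec_eq hmem.1 hP hA'⟩

/-- Pairs consisting of a frame and a coordinate matrix describing the configurations in the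
intersection of two charts. -/
def chartParameters (k : ℕ) (P P' : Matrix (Fin (i + 1)) (Fin (n + 1)) ℂ)
    (f f' : Dual ℂ (Fin (n + 1) → ℂ)) :
    Set ((Fin (n + 1) → Fin (i + 1) → ℂ) × (Fin (i + 1) → Fin k → ℂ)) :=
  {z | z.2 ∈ spreadMatrices (i + 1) k} ∩
    ({z | (P * Matrix.of z.1).det ≠ 0} ∩ {z | (P' * Matrix.of z.1).det ≠ 0} ∩
      ((⋂ j, {z | f (Matrix.of z.1 *ᵥ fun t => z.2 t j) ≠ 0}) ∩
        ⋂ j, {z | f' (Matrix.of z.1 *ᵥ fun t => z.2 t j) ≠ 0}))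

theorem lineGeneric_det_mul_ne_zero (Q : Matrix (Fin (i + 1)) (Fin (n + 1)) ℂ) :
    LineGeneric {A : Fin (n + 1) → Fin (i + 1) → ℂ | (Q * Matrix.of A).det ≠ 0} := by
  refine LineGeneric.of_ne_zero _ (Differentiable.matrix_det fun a b => ?_)
  simp only [Matrix.mul_apply, Matrix.of_apply]
  fun_prop

theorem lineGeneric_apply_mulVec_ne_zero (g : Dual ℂ (Fin (n + 1) → ℂ)) (j : Fin k) :
    LineGeneric {z : (Fin (n + 1) → Fin (i + 1) → ℂ) × (Fin (i + 1) → Fin k → ℂ) |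
      g (Matrix.of z.1 *ᵥ fun t => z.2 t j) ≠ 0} := by
  refine LineGeneric.of_ne_zero _ ?_
  refine g.toContinuousLinearMap.differentiable.comp (differentiable_pi.2 fun s => ?_)
  simp only [Matrix.mulVec, dotProduct, Matrix.of_apply]
  fun_prop

theorem lineGeneric_chartParameters (P P' : Matrix (Fin (i + 1)) (Fin (n + 1)) ℂ)
    (f f' : Dual ℂ (Fin (n + 1) → ℂ)) : LineGeneric (chartParameters k P P' f f') := by
  refine LineGeneric.inter ?_ (LineGeneric.inter (LineGeneric.inter ?_ ?_)
    (LineGeneric.inter ?_ ?_))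
  · exact (lineGeneric_spreadMatrices (i + 1) k).preimage
      (LinearMap.snd ℂ (Fin (n + 1) → Fin (i + 1) → ℂ) (Fin (i + 1) → Fin k → ℂ))
  · exact (lineGeneric_det_mul_ne_zero P).preimage
      (LinearMap.fst ℂ (Fin (n + 1) → Fin (i + 1) → ℂ) (Fin (i + 1) → Fin k → ℂ))
  · exact (lineGeneric_det_mul_ne_zero P').preimage
      (LinearMap.fst ℂ (Fin (n + 1) → Fin (i + 1) → ℂ) (Fin (i + 1) → Fin k → ℂ))
  · exact LineGeneric.iInter fun j => lineGeneric_apply_mulVec_ne_zero f j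
  · exact LineGeneric.iInter fun j => lineGeneric_apply_mulVec_ne_zero f' j

theorem det_mul_ne_zero_iff (Q : Matrix (Fin (i + 1)) (Fin (n + 1)) ℂ)
    (A : Matrix (Fin (n + 1)) (Fin (i + 1)) ℂ) {B : Fin (i + 1) → Fin k → ℂ}
    (hB : LinearIndependent ℂ B) : (Q * A).det ≠ 0 ↔
      LinearIndependent ℂ fun t j => (Q *ᵥ (A *ᵥ fun t => B t j)) t := by
  have hB' := linearIndependent_rows_iff.1 hB
  rw [linearIndependent_rows_iff]
  simp only [Matrix.mulVec_mulVec, Matrix.dotProduct_mulVec]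
  constructor
  · intro h y hy
    exact Matrix.eq_zero_of_vecMul_eq_zero h (hB' _ hy)
  · intro h h0
    obtain ⟨y, hy, hy0⟩ := Matrix.exists_vecMul_eq_zero_iff.2 h0
    exact hy (h y fun j => by rw [hy0, zero_dotProduct])

theorem isPathConnected_confChart_inter (hk : 2 ≤ k)
    (P P' : Matrix (Fin (i + 1)) (Fin (n + 1)) ℂ) (f f' : Dual ℂ (Fin (n + 1) → ℂ))
    (hne : (confChart k P f ∩ confChart k P' f').Nonempty) :
    IsPathConnected (confChart k P f ∩ confChart k P' f') := by
  set O := chartParameters k P P' f f'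
  have hinj : ∀ z : O, ∀ y, Matrix.of z.1.1 *ᵥ y = 0 → y = 0 := fun z =>
    eq_zero_of_mulVec_eq_zero_of_isUnit_det (isUnit_iff_ne_zero.2 z.2.2.1.1)
  have hne0 : ∀ (z : O) j, (Matrix.of z.1.1 *ᵥ fun t => z.1.2 t j) ≠ 0 := fun z j h =>
    col_ne_zero hk z.2.1 j (hinj z _ h)
  let g : O → Fconf k i n := fun z => ⟨_, mk_mulVec_mem_Fconf (hinj z) z.2.1 (hne0 z)⟩
  have hg : Continuous g := by
    refine Continuous.subtype_mk (continuous_pi fun j => continuous_mk ?_ _) _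
    refine continuous_pi fun s => ?_
    simp only [Matrix.mulVec, dotProduct, Matrix.of_apply]
    fun_prop
  have hrange : confChart k P f ∩ confChart k P' f' = range g := by
    ext x
    constructor
    · rintro ⟨hx, hx'⟩
      obtain ⟨A, hPA, hA, hB⟩ := exists_frame hx
      have hxmk : x = ⟨fun j => mk ℂ (normalize f (x.1 j)) (normalize_ne_zero f (hx.1 j)), by
          simpa only [mk_normalize f (hx.1 _)] using x.2⟩ :=
        Subtype.ext (funext fun j => (mk_normalize f (hx.1 j)).symm)
      have h2 := hx'
      rw [hxmk, mk_mem_confChart_iff] at h2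
      have hA' : ∀ j, (Matrix.of (A : Fin (n + 1) → Fin (i + 1) → ℂ) *ᵥ
        fun t => (P *ᵥ normalize f (x.1 j)) t) = normalize f (x.1 j) := hA
      refine ⟨⟨(A, fun t j => (P *ᵥ normalize f (x.1 j)) t), hB, ⟨?_, ?_⟩, ?_, ?_⟩, ?_⟩
      · change (P * A).det ≠ 0
        rw [hPA, Matrix.det_one]
        exact one_ne_zero
      · refine (det_mul_ne_zero_iff P' _ hB.1).2 ?_
        simpa only [hA'] using h2.2
      · refine mem_iInter.2 fun j => ?_
        rw [mem_ofPred_eq, hA', apply_normalize f (hx.1 j)]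
        exact one_ne_zero
      · refine mem_iInter.2 fun j => ?_
        rw [mem_ofPred_eq, hA']
        exact h2.1 j
      · refine Subtype.ext (funext fun j => ?_)
        refine Eq.trans ?_ (mk_normalize f (hx.1 j))
        simp only [g, hA']
    · rintro ⟨z, rfl⟩
      refine ⟨mk_mem_confChart_iff.2 ⟨fun j => mem_iInter.1 z.2.2.2.1 j, ?_⟩,
        mk_mem_confChart_iff.2 ⟨fun j => mem_iInter.1 z.2.2.2.2 j, ?_⟩⟩
      · exact (det_mul_ne_zero_iff P _ z.2.1.1).1 z.2.2.1.1
      · exact (det_mul_ne_zero_iff P' _ z.2.1.1).1 z.2.2.1.2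
  rw [hrange] at hne ⊢
  obtain ⟨-, z, -⟩ := hne
  have := isPathConnected_iff_pathConnectedSpace.1
    ((lineGeneric_chartParameters P P' f f').isPathConnected ⟨z.1, z.2⟩)
  exact isPathConnected_range hg

theorem continuous_matrix_inv {T : Type*} [TopologicalSpace T] {r : ℕ}
    {M : T → Matrix (Fin r) (Fin r) ℂ} (hM : Continuous M) (h : ∀ t, (M t).det ≠ 0) :
    Continuous fun t => (M t)⁻¹ := by
  simp only [Matrix.inv_def, Ring.inverse_eq_inv']
  exact (hM.matrix_det.inv₀ h).smul hM.matrix_adjugate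

theorem homotopic_of_range_subset_confChart (hk : 2 ≤ k)
    (hB : SimplyConnectedSpace (spreadMatrices (i + 1) k))
    (P : Matrix (Fin (i + 1)) (Fin (n + 1)) ℂ) (f : Dual ℂ (Fin (n + 1) → ℂ))
    {x y : Fconf k i n} (p q : Path x y) (hp : range p ⊆ confChart k P f)
    (hq : range q ⊆ confChart k P f) : p.Homotopic q := by
  let F : Set (Matrix (Fin (n + 1)) (Fin (i + 1)) ℂ) := {A | P * A = 1}
  have hFinj : ∀ A : F, ∀ y, A.1 *ᵥ y = 0 → y = 0 := fun A =>
    eq_zero_of_mulVec_eq_zero_of_isUnit_det (P := P) (by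
      have : P * A.1 = 1 := A.2
      simp [this])
  have hFconvex : Convex ℝ F := by
    intro A hA A' hA' a b _ _ hab
    have hA1 : P * A = 1 := hA
    have hA2 : P * A' = 1 := hA'
    change P * (a • A + b • A') = 1
    rw [Matrix.mul_add, Matrix.mul_smul, Matrix.mul_smul, hA1, hA2, ← add_smul, hab, one_smul]
  have hF : ContractibleSpace F := hFconvex.contractibleSpace (by
    obtain ⟨A, hA, -⟩ := exists_frame (hp ⟨0, p.source⟩)
    exact ⟨A, hA⟩)
  let Φ : F × spreadMatrices (i + 1) k → Fconf k i n := fun z =>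
    ⟨_, mk_mulVec_mem_Fconf (hFinj z.1) z.2.2 fun j h => col_ne_zero hk z.2.2 j (hFinj z.1 _ h)⟩
  have hΦ : Continuous Φ := by
    refine Continuous.subtype_mk (continuous_pi fun j => continuous_mk ?_ _) _
    exact Continuous.matrix_mulVec (continuous_subtype_val.comp continuous_fst)
      (continuous_pi fun t => (continuous_apply j).comp
        ((continuous_apply t).comp (continuous_subtype_val.comp continuous_snd)))
  let V : confChart k P f → Matrix (Fin (n + 1)) (Fin k) ℂ := fun x =>
    Matrix.of fun s j => normalize f (x.1.1 j) s
  have hV : Continuous V := by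
    refine continuous_pi fun s => continuous_pi fun j => ?_
    have h := (continuousOn_normalize_coordinate f j).comp_continuous continuous_subtype_val
      fun x : confChart k P f => x.2.1
    exact (continuous_apply s).comp h
  have hPV : Continuous fun x => P * V x := continuous_const.matrix_mul hV
  have hdet : ∀ x, ((P * V x) * (P * V x)ᴴ).det ≠ 0 := fun x =>
    det_mul_conjTranspose_ne_zero (mem_confChart_iff_normalize.1 x.2).2
  let A : confChart k P f → Matrix (Fin (n + 1)) (Fin (i + 1)) ℂ := fun x =>
    V x * (P * V x)ᴴ * ((P * V x) * (P * V x)ᴴ)⁻¹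
  have hA : Continuous A := (hV.matrix_mul hPV.matrix_conjTranspose).matrix_mul
    (continuous_matrix_inv (hPV.matrix_mul hPV.matrix_conjTranspose) hdet)
  have hframe : ∀ x, P * A x = 1 ∧ A x * (P * V x) = V x := by
    intro x
    obtain ⟨A₀, hPA, hAV, -⟩ := exists_frame x.2
    have h0 : A₀ * (P * V x) = V x := by
      ext s j
      exact congrFun (hAV j) s
    have : A x = A₀ := by
      change V x * (P * V x)ᴴ * ((P * V x) * (P * V x)ᴴ)⁻¹ = A₀
      conv_lhs => enter [1, 1]; rw [← h0]
      rw [Matrix.mul_assoc A₀, Matrix.mul_nonsing_inv_cancel_right _ _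
        (isUnit_iff_ne_zero.2 (hdet x))]
    rw [this]
    exact ⟨hPA, h0⟩
  let Ψ : confChart k P f → F × spreadMatrices (i + 1) k := fun x =>
    (⟨A x, (hframe x).1⟩, ⟨P * V x, (exists_frame x.2).choose_spec.2.2⟩)
  have hΨ : Continuous Ψ := (hA.subtype_mk _).prodMk (hPV.subtype_mk _)
  have hY : SimplyConnectedSpace (F × spreadMatrices (i + 1) k) := SimplyConnectedSpace.prod
  refine homotopic_of_factor Φ hΦ Ψ hΨ (fun z => Subtype.ext (funext fun j => ?_)) x y p q hp hq
  refine Eq.trans ?_ (mk_normalize f (z.2.1 j))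
  have hcol : (A z *ᵥ fun t => (P * V z) t j) = normalize f (z.1.1 j) :=
    funext fun s => congrFun (congrFun (hframe z).2 s) j
  simp only [Φ, Ψ, hcol]

theorem exists_linearIndependent_rows (x : Fconf k i n) :
    ∃ P : Matrix (Fin (i + 1)) (Fin (n + 1)) ℂ,
      LinearIndependent ℂ fun t j => (P *ᵥ (x.1 j).rep) t := by
  let S := span ℂ (range fun j => (x.1 j).rep)
  let e : S ≃ₗ[ℂ] (Fin (i + 1) → ℂ) := LinearEquiv.ofFinrankEq _ _ (by simpa using x.2.2)
  obtain ⟨g, hg⟩ := LinearMap.exists_extend e.toLinearMap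
  refine ⟨LinearMap.toMatrix' g, linearIndependent_rows_iff.2 fun y hy => ?_⟩
  have hle : S ≤ LinearMap.ker (dotProductEquiv ℂ (Fin (i + 1)) y ∘ₗ g) := by
    refine span_le.2 ?_
    rintro _ ⟨j, rfl⟩
    simpa using hy j
  have hy0 : dotProductEquiv ℂ (Fin (i + 1)) y = 0 := by
    refine LinearMap.ext fun w => ?_
    have h1 : g (e.symm w) = w := by
      simpa using LinearMap.congr_fun hg (e.symm w)
    simpa [h1] using hle (e.symm w).2
  simpa using hy0

theorem exists_mem_confChart (x y : Fconf k i n) :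
    ∃ (P : Matrix (Fin (i + 1)) (Fin (n + 1)) ℂ) (f : Dual ℂ (Fin (n + 1) → ℂ)),
      x ∈ confChart k P f ∧ y ∈ confChart k P f := by
  obtain ⟨f, hf⟩ := Module.exists_dual_forall_apply_ne_zero (K := ℂ)
    (Sum.elim (fun j => (x.1 j).rep) fun j => (y.1 j).rep) (by
      rintro (j | j) <;> exact rep_nonzero _)
  obtain ⟨P, hP⟩ := exists_linearIndependent_rows x
  obtain ⟨Q, hQ⟩ := exists_linearIndependent_rows y
  rw [← indepMod_bot_iff, indepMod_iff_exists_det_ne_zero] at hP hQ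
  obtain ⟨p, hp⟩ := hP
  obtain ⟨q, hq⟩ := hQ
  have hd : ∀ (l : (Fin k → ℂ) →ₗ[ℂ] Fin (i + 1) → ℂ) (v : Fin k → Fin (n + 1) → ℂ),
      Differentiable ℂ fun R : Fin (i + 1) → Fin (n + 1) → ℂ =>
        (Matrix.of fun a b => l (fun j => (Matrix.of R *ᵥ v j) b) a).det := by
    intro l v
    refine Differentiable.matrix_det fun a b => ?_
    refine (LinearMap.proj a ∘ₗ l :
      (Fin k → ℂ) →ₗ[ℂ] ℂ).toContinuousLinearMap.differentiable.comp
        (differentiable_pi.2 fun j => ?_)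
    simp only [Matrix.mulVec, dotProduct, Matrix.of_apply]
    fun_prop
  obtain ⟨R, hRp, hRq⟩ := exists_ne_zero_and_ne_zero (hd p.1 fun j => (x.1 j).rep)
    (hd q.1 fun j => (y.1 j).rep) (x := P) (y := Q) hp hq
  refine ⟨Matrix.of R, f, ⟨fun j => hf (Sum.inl j), ?_⟩, ⟨fun j => hf (Sum.inr j), ?_⟩⟩
  · exact indepMod_bot_iff.1 (indepMod_iff_exists_det_ne_zero.2 ⟨p, hRp⟩)
  · exact indepMod_bot_iff.1 (indepMod_iff_exists_det_ne_zero.2 ⟨q, hRq⟩)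

theorem Fconf_nonempty (hin : i ≤ n) (hk : 2 ≤ k) (hB : (spreadMatrices (i + 1) k).Nonempty) :
    (Fconf k i n).Nonempty := by
  obtain ⟨B, hB⟩ := hB
  let A : Matrix (Fin (n + 1)) (Fin (i + 1)) ℂ :=
    Matrix.of fun s t => if s = Fin.castLE (Nat.succ_le_succ hin) t then 1 else 0
  have hA : ∀ y, A *ᵥ y = 0 → y = 0 := by
    intro y hy
    funext t
    simpa [A, Matrix.mulVec, dotProduct] using
      congrFun hy (Fin.castLE (Nat.succ_le_succ hin) t)
  exact ⟨_, mk_mulVec_mem_Fconf hA hB fun j h => col_ne_zero hk hB j (hA _ h)⟩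

theorem Fconf_simplyConnected_of_add_two_le (hi : 2 ≤ i) (hin : i ≤ n) (hk : i + 2 ≤ k) :
    SimplyConnectedSpace (Fconf k i n) := by
  have hk2 : 2 ≤ k := by omega
  have hB : SimplyConnectedSpace (spreadMatrices (i + 1) k) :=
    simplyConnectedSpace_spreadMatrices (by omega) (by omega)
  have hne : (spreadMatrices (i + 1) k).Nonempty := by
    have : PathConnectedSpace (spreadMatrices (i + 1) k) := inferInstance
    exact nonempty_coe_sort.1 this.nonempty
  obtain ⟨x₀, hx₀⟩ := Fconf_nonempty hin hk2 hne
  refine simplyConnectedSpace_of_open_cover (⟨x₀, hx₀⟩ : Fconf k i n)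
    {U | ∃ P f, ⟨x₀, hx₀⟩ ∈ confChart k P f ∧ U = confChart k P f} ?_ ?_ ?_ ?_ ?_
  · rintro _ ⟨P, f, -, rfl⟩
    exact isOpen_confChart P f
  · intro x
    obtain ⟨P, f, hx, h0⟩ := exists_mem_confChart x ⟨x₀, hx₀⟩
    exact ⟨_, ⟨P, f, h0, rfl⟩, hx⟩
  · rintro _ ⟨P, f, h0, rfl⟩
    exact h0
  · rintro _ ⟨P, f, h0, rfl⟩ _ ⟨P', f', h0', rfl⟩
    exact isPathConnected_confChart_inter hk2 P P' f f' ⟨_, h0, h0'⟩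
  · rintro _ ⟨P, f, -, rfl⟩ x y p q hp hq
    exact homotopic_of_range_subset_confChart hk2 hB P f p q hp hq

theorem Fconf_eq_indepConf : Fconf (i + 1) i n = indepConf (Fin (n + 1) → ℂ) ⊥ (i + 1) := by
  ext x
  have h : x ∈ indepConf (Fin (n + 1) → ℂ) ⊥ (i + 1) ↔
      finrank ℂ (span ℂ (range fun j => (x j).rep)) = i + 1 := by
    rw [indepConf, mem_ofPred_eq, indepMod_bot_iff, linearIndependent_iff_card_eq_finrank_span,
      Fintype.card_fin, Set.finrank, eq_comm]
  rw [h]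
  refine ⟨fun hx => hx.2, fun hx => ⟨fun a b hab => ?_, hx⟩⟩
  exact (indepMod_bot_iff.1 (h.2 hx)).injective (congrArg Projectivization.rep hab)

end Configurations

end Auxiliary

/-- For `2 ≤ i ≤ n` and `k ≥ i + 1`, the ordered configuration space `F_k^{i,n}` is
simply connected. -/
theorem Fconf_simplyConnected (i k n : ℕ) (hi : 2 ≤ i) (hin : i ≤ n) (hk : i + 1 ≤ k) :
    SimplyConnectedSpace (Fconf k i n) := by
  rcases hk.eq_or_lt with rfl | hk
  · rw [Fconf_eq_indepConf]
    exact simplyConnectedSpace_indepConf _ _ (by simpa using hin)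
  · exact Fconf_simplyConnected_of_add_two_le hi hin hk
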